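/- Let p be a prime, let U be a field of characteristic p, and let k ⊆ K and k ⊆ L be subfields of U such that the extensions k ⊆ K, k ⊆ L, K ⊆ U and L ⊆ U are all separable. If K is algebraically independent from L over k and the extension KL ⊆ U of the compositum is separable, then K is p-independent from L over k in U (i.e., every subset of K that is p-independent in U over k remains p-independent in U over L). -/

import Mathlib

/-- The subfield generated by a subfield `k` and a subset `S` of the ambient field. -/
def Subfield.adjoinSet {F : Type*} [Field F] (k : Subfield F) (S : Set F) : Subfield F :=
  Subfield.closure (↑k ∪ S)

/-- The subfield of `p`-th powers of a subfield `K`. -/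
def Subfield.pPow {F : Type*} [Field F] (p : ℕ) (K : Subfield F) : Subfield F :=
  Subfield.closure ((fun x : F => x ^ p) '' (K : Set F))

/-- `K₁` is linearly disjoint from `K₂` over a common subfield `k₀`: every subset of `K₁`
which is `k₀`-linearly independent remains `K₂`-linearly independent. -/
def LinDisjOver {F : Type*} [Field F] (k₀ K₁ K₂ : Subfield F) : Prop :=
  ∀ S : Set F, S ⊆ (K₁ : Set F) →
    LinearIndependent k₀ (Subtype.val : S → F) →
    LinearIndependent K₂ (Subtype.val : S → F)

/-- The extension `k ⊆ K` (in characteristic `p`) is separable if `k` is linearly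
disjoint from `K^p` over `k^p`. -/
def SepExt {F : Type*} [Field F] (p : ℕ) (k K : Subfield F) : Prop :=
  LinDisjOver (k.pPow p) k (K.pPow p)

/-- A subset `B` is algebraically independent over a subfield `k₀` if no element of `B`
is algebraic over the subfield generated by `k₀` and the other elements of `B`. -/
def AlgIndepOver {F : Type*} [Field F] (k₀ : Subfield F) (B : Set F) : Prop :=
  ∀ b ∈ B, ¬ IsAlgebraic (k₀.adjoinSet (B \ {b})) b

/-- `K` is algebraically independent (free) from `L` over `k`: every subset of `K`
algebraically independent over `k` remains algebraically independent over `L`. -/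
def AlgIndepFrom {F : Type*} [Field F] (k K L : Subfield F) : Prop :=
  ∀ S : Set F, S ⊆ (K : Set F) → AlgIndepOver k S → AlgIndepOver L S

/-- A subset `S` of a subfield `M` is `p`-independent in `M` over `k₀` if no `s ∈ S`
lies in the subfield `M^p · k₀(S ∖ {s})`. -/
def PIndepOver {F : Type*} [Field F] (p : ℕ) (k₀ M : Subfield F) (S : Set F) : Prop :=
  ∀ s ∈ S,
    s ∉ Subfield.closure ((fun x : F => x ^ p) '' (M : Set F) ∪ ↑k₀ ∪ (S \ {s}))

open scoped TensorProduct

theorem IsAlgebraic.of_ringHom_of_algebraMap_comp_eq {R S A : Type*} [CommRing R] [CommRing S]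
    [Ring A] [Algebra R A] [Algebra S A] (f : R →+* S) (hf : Function.Injective f)
    (h : ∀ r, algebraMap S A (f r) = algebraMap R A r) {x : A} (hx : IsAlgebraic R x) :
    IsAlgebraic S x := by
  let _ := f.toAlgebra
  have : IsScalarTower R S A := .of_algebraMap_eq fun r ↦ (h r).symm
  exact hx.extendScalars hf

theorem Subfield.mem_pPow {F : Type*} [Field F] {p : ℕ} [Fact p.Prime] [CharP F p]
    {K : Subfield F} {x : F} : x ∈ K.pPow p ↔ ∃ y ∈ K, y ^ p = x := by
  have : K.pPow p = K.map (frobenius F p) := by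
    rw [Subfield.pPow]
    exact (Subfield.closure_eq (K.map (frobenius F p)))
  rw [this, Subfield.mem_map]
  rfl

theorem AlgIndepOver.algebraicIndependent {F : Type*} [Field F] {k : Subfield F} {S : Set F}
    (h : AlgIndepOver k S) : AlgebraicIndependent k ((↑) : S → F) := by
  refine algebraicIndependent_of_finite' S (algebraMap k F).injective
    fun t ht _ _ a ha hat halg ↦ h a ha ?_
  have hle : (Algebra.adjoin k t).toSubring ≤ (k.adjoinSet (S \ {a})).toSubring := by
    intro x hx
    refine Algebra.adjoin_induction (p := fun x _ ↦ x ∈ k.adjoinSet (S \ {a})) ?_ ?_ ?_ ?_ hx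
    · exact fun x hx ↦ Subfield.subset_closure
        (.inr ⟨ht hx, fun hxa ↦ hat ((Set.mem_singleton_iff.mp hxa) ▸ hx)⟩)
    · exact fun r ↦ Subfield.subset_closure (.inl r.2)
    · exact fun _ _ _ _ ↦ add_mem
    · exact fun _ _ _ _ ↦ mul_mem
  exact halg.of_ringHom_of_algebraMap_comp_eq (Subring.inclusion hle)
    (Subring.inclusion_injective hle) fun _ ↦ rfl

theorem AlgebraicIndependent.algIndepOver {F : Type*} [Field F] {k : Subfield F} {S : Set F}
    (h : AlgebraicIndependent k ((↑) : S → F)) : AlgIndepOver k S := by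
  intro b hb halg
  have hle : k.adjoinSet (S \ {b}) ≤ (IntermediateField.adjoin k (S \ {b})).toSubfield := by
    refine Subfield.closure_le.mpr (Set.union_subset (fun x hx ↦ ?_) ?_)
    · exact (IntermediateField.adjoin k (S \ {b})).algebraMap_mem ⟨x, hx⟩
    · exact IntermediateField.subset_adjoin k _
  have h1 : IsAlgebraic (IntermediateField.adjoin k (S \ {b})) b :=
    halg.of_ringHom_of_algebraMap_comp_eq (Subfield.inclusion hle)
      (Subfield.inclusion hle).injective fun _ ↦ rfl
  have h2 := h.transcendental_adjoin (s := {x | x.1 ≠ b}) (i := ⟨b, hb⟩) (by simp)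
  have h3 : ((↑) : S → F) '' {x | x.1 ≠ b} = S \ {b} := by
    ext x; simp [and_comm]
  rw [h3] at h2
  exact h2 (IntermediateField.isAlgebraic_adjoin_iff.mp h1)

theorem Subfield.mem_span_of_mem_closure {F : Type*} [Field F] {p : ℕ} (hp : p ≠ 0)
    {E N : Subfield F} (hE : ∀ x : F, x ^ p ∈ E) {x : F}
    (hx : x ∈ Subfield.closure ((E : Set F) ∪ N)) : x ∈ Submodule.span E (N : Set F) := by
  have hring : ∀ y ∈ Subring.closure ((E : Set F) ∪ N), y ∈ Submodule.span E (N : Set F) := by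
    intro y hy
    have hy' : y ∈ (Algebra.adjoin E (N : Set F)) := by
      refine (Subring.closure_le (t := (Algebra.adjoin E (N : Set F)).toSubring)).mpr ?_ hy
      exact Set.union_subset (fun z hz ↦ (Algebra.adjoin E (N : Set F)).algebraMap_mem ⟨z, hz⟩)
        Algebra.subset_adjoin
    rw [← Subalgebra.mem_toSubmodule, Algebra.adjoin_eq_span] at hy'
    rwa [show ((Submonoid.closure (N : Set F) : Submonoid F) : Set F) = N from
      congrArg _ (Submonoid.closure_eq N.toSubmonoid)] at hy'
  obtain ⟨y, hy, z, hz, rfl⟩ := Subfield.mem_closure_iff.mp hx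
  rcases eq_or_ne z 0 with rfl | hz0
  · simp
  have : y / z = (⟨(z ^ p)⁻¹, inv_mem (hE z)⟩ : E) • (y * z ^ (p - 1)) := by
    rw [Subfield.smul_def, smul_eq_mul]
    obtain ⟨n, rfl⟩ := Nat.exists_eq_succ_of_ne_zero hp
    simp only [Nat.succ_eq_add_one, Nat.add_sub_cancel]
    field_simp
    ring
  rw [this]
  exact Submodule.smul_mem _ _ (hring _ (mul_mem hy (pow_mem hz _)))

theorem SepExt.mem_of_mem_closure {F : Type*} [Field F] {p : ℕ} [Fact p.Prime] [CharP F p]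
    {M N : Subfield F} (h : SepExt p M ⊤) (hMN : M.pPow p ≤ N) (hNM : N ≤ M) {s : F}
    (hs : s ∈ M) (hsN : s ∈ Subfield.closure ((fun x : F ↦ x ^ p) '' (⊤ : Subfield F) ∪ N)) :
    s ∈ N := by
  by_contra hsn
  let V : Submodule (M.pPow p) F :=
    { N.toAddSubgroup with
      smul_mem' := fun c x hx ↦ N.mul_mem (hMN c.2) hx }
  obtain ⟨T, hTV, hT, hTi⟩ := exists_linearIndependent (M.pPow p) (V : Set F)
  have hspan : Submodule.span (M.pPow p) T = V := by rw [hT, Submodule.span_eq]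
  have hins : LinearIndepOn (M.pPow p) id (insert s T) :=
    LinearIndepOn.id_insert hTi (by rw [hspan]; exact hsn)
  have h1 : LinearIndepOn ((⊤ : Subfield F).pPow p) id (insert s T) :=
    h (insert s T) (Set.insert_subset hs fun x hx ↦ hNM (hTV hx)) hins
  have hsT : s ∉ T := fun h ↦ hsn (hTV h)
  refine LinearIndepOn.notMem_span_of_insert h1 hsT ?_
  rw [id, Set.image_id]
  have h2 : s ∈ Submodule.span ((⊤ : Subfield F).pPow p) (N : Set F) := by
    refine Subfield.mem_span_of_mem_closure (Fact.out : p.Prime).ne_zero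
      (fun x ↦ Subfield.mem_pPow.mpr ⟨x, Subfield.mem_top x, rfl⟩) ?_
    refine Subfield.closure_mono (Set.union_subset_union_left _ ?_) hsN
    rintro _ ⟨x, -, rfl⟩
    exact Subfield.mem_pPow.mpr ⟨x, Subfield.mem_top x, rfl⟩
  refine Submodule.span_le.mpr (fun x hx ↦ ?_) h2
  have hx' : x ∈ Submodule.span (M.pPow p) T := by rw [hspan]; exact hx
  have hle : M.pPow p ≤ (⊤ : Subfield F).pPow p :=
    Subfield.closure_mono (Set.image_mono fun _ _ ↦ trivial)
  refine Submodule.span_induction (fun y hy ↦ Submodule.subset_span hy) (zero_mem _)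
    (fun _ _ _ _ ↦ add_mem) (fun c y _ hy ↦ ?_) hx'
  exact Submodule.smul_mem _ (⟨c, hle c.2⟩ : (⊤ : Subfield F).pPow p) hy

universe v

theorem SepExt.linearIndependent_pow {F : Type*} [Field F] {p : ℕ} [Fact p.Prime] [CharP F p]
    {k K : Subfield F} (h : SepExt p k K) (hkK : k ≤ K) {ι : Type*} {v : ι → F}
    (hvK : ∀ i, v i ∈ K) (hv : LinearIndependent k v) :
    LinearIndependent k (fun i ↦ v i ^ p) := by
  have hp : (p : ℕ) ≠ 0 := (Fact.out : p.Prime).ne_zero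
  have hle : k.pPow p ≤ k := by
    intro x hx
    obtain ⟨y, hy, rfl⟩ := Subfield.mem_pPow.mp hx
    exact pow_mem hy p
  have hle' : k.pPow p ≤ K.pPow p := Subfield.closure_mono (Set.image_mono hkK)
  let A : IntermediateField (k.pPow p) F := k.toIntermediateField fun x ↦ hle x.2
  let B : IntermediateField (k.pPow p) F := (K.pPow p).toIntermediateField fun x ↦ hle' x.2
  have hdisj : A.LinearDisjoint B := by
    let b := Module.Basis.ofVectorSpace (k.pPow p) A
    have hb : LinearIndependent (k.pPow p) (fun i ↦ (b i : F)) :=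
      b.linearIndependent.map' A.val.toLinearMap
        (LinearMap.ker_eq_bot.mpr A.val.injective)
    have hb' := h (Set.range fun i ↦ (b i : F)) (by rintro _ ⟨i, rfl⟩; exact (b i).2)
      hb.linearIndepOn_id
    exact .of_basis_left b (.of_linearIndepOn_id_range hb.injective hb')
  have hw : LinearIndependent (k.pPow p)
      (fun i ↦ (⟨v i ^ p, Subfield.mem_pPow.mpr ⟨v i, hvK i, rfl⟩⟩ : B)) := by
    rw [linearIndependent_iff']
    intro s g hg i hi
    choose c hck hc using fun i ↦ Subfield.mem_pPow.mp (g i).2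
    have h0 : ∑ j ∈ s, (⟨c j, hck j⟩ : k) • v j = 0 := by
      refine pow_eq_zero_iff hp |>.mp ?_
      rw [sum_pow_char]
      have := congrArg (Subtype.val : B → F) hg
      rw [AddSubmonoidClass.coe_finsetSum] at this
      rw [← ZeroMemClass.coe_zero B, ← this]
      refine Finset.sum_congr rfl fun j _ ↦ ?_
      rw [Subfield.smul_def, smul_eq_mul, mul_pow, hc]
      rfl
    have := congrArg Subtype.val (linearIndependent_iff'.mp hv s _ h0 i hi)
    refine Subtype.ext ?_
    rw [← hc, show c i = 0 from this, zero_pow hp]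
    rfl
  exact hdisj.linearIndependent_right hw

theorem isReduced_tensorProduct_of_linearIndependent_pow {k A : Type*} {K : Type v} [Field k]
    [CommRing A] [Algebra k A] [IsReduced A] [Field K] [Algebra k K] (p : ℕ) [Fact p.Prime]
    [CharP k p] (h : ∀ {ι : Type v} (v : ι → K), LinearIndependent k v →
      LinearIndependent k (fun i ↦ v i ^ p)) :
    IsReduced (A ⊗[k] K) := by
  have : ExpChar k p := .prime Fact.out
  nontriviality A ⊗[k] K
  have : ExpChar (A ⊗[k] K) p := expChar_of_injective_algebraMap (algebraMap k _).injective p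
  rw [isReduced_iff_pow_one_lt p (Fact.out : p.Prime).one_lt]
  intro z hz
  let b := Module.Basis.ofVectorSpace k K
  let b' := Algebra.TensorProduct.basis A b
  have hind := Module.Flat.linearIndependent_one_tmul (S := A) (h _ b.linearIndependent)
  rw [← b'.linearCombination_repr z, Finsupp.linearCombination_apply, Finsupp.sum,
    sum_pow_char] at hz
  have h0 := linearIndependent_iff'.mp hind (b'.repr z).support (fun i ↦ b'.repr z i ^ p) (by
    rw [← hz]
    refine Finset.sum_congr rfl fun i _ ↦ ?_
    simp [b', smul_pow])
  refine b'.repr.map_eq_zero_iff.mp (Finsupp.ext fun i ↦ ?_)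
  by_cases hi : i ∈ (b'.repr z).support
  · exact pow_eq_zero_iff (Fact.out : p.Prime).ne_zero |>.mp (h0 i hi)
  · simpa using hi

/-- If a transcendence basis of `K / k` stays algebraically independent over `L`, the kernel
of `L ⊗ K → U` becomes trivial after localizing at that kernel. -/
theorem exists_mul_eq_zero_of_algebraicIndependent {k L K U : Type*} [Field k] [Field L] [Field K]
    [Field U] [Algebra k L] [Algebra k K] [Algebra L U] [Algebra k U] [IsScalarTower k L U]
    [IsReduced (L ⊗[k] K)] (g : K →ₐ[k] U)
    {ι : Type*} {x : ι → K} (hx : IsTranscendenceBasis k x)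
    (hxL : AlgebraicIndependent L (g ∘ x)) {z : L ⊗[k] K}
    (hz : Algebra.TensorProduct.productLeftAlgHom (Algebra.ofId L U) g z = 0) :
    ∃ w, Algebra.TensorProduct.productLeftAlgHom (Algebra.ofId L U) g w ≠ 0 ∧ w * z = 0 := by
  set φ := Algebra.TensorProduct.productLeftAlgHom (Algebra.ofId L U) g with hφ
  let y : ι → L ⊗[k] K := fun i ↦ 1 ⊗ₜ x i
  let R := Algebra.adjoin L (Set.range y)
  have hφy : φ ∘ y = g ∘ x := by
    ext i; simp [hφ, y]
  have hinj : ∀ r ∈ R, φ r = 0 → r = 0 := by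
    intro r hr h0
    rw [show R = _ from Algebra.adjoin_range_eq_range_aeval L y] at hr
    obtain ⟨P, rfl⟩ := hr
    rw [AlgHom.toRingHom_eq_coe, RingHom.coe_coe, ← AlgHom.comp_apply, MvPolynomial.comp_aeval] at h0
    rw [← hφy] at hxL
    have : P = 0 := (injective_iff_map_eq_zero _).mp hxL P h0
    simp [this]
  let ψ : R →+* U := (φ : L ⊗[k] K →+* U).comp R.subtype
  have hψ : Function.Injective ψ :=
    (injective_iff_map_eq_zero _).mpr fun r hr ↦ Subtype.ext (hinj r r.2 hr)
  have : IsDomain R := hψ.isDomain ψ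
  have halgK (a : K) : IsAlgebraic R (1 ⊗ₜ[k] a : L ⊗[k] K) := by
    have ha := hx.isAlgebraic.isAlgebraic a
    have h1 : ∀ c ∈ Algebra.adjoin k (Set.range x),
        (Algebra.TensorProduct.includeRight c : L ⊗[k] K) ∈ R := by
      intro c hc
      induction hc using Algebra.adjoin_induction with
      | mem c hc =>
        obtain ⟨i, rfl⟩ := hc
        exact Algebra.subset_adjoin ⟨i, rfl⟩
      | algebraMap r =>
        rw [AlgHom.commutes, IsScalarTower.algebraMap_apply k L]
        exact R.algebraMap_mem _
      | add c d _ _ hc hd => rw [map_add]; exact add_mem hc hd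
      | mul c d _ _ hc hd => rw [map_mul]; exact mul_mem hc hd
    let f : Algebra.adjoin k (Set.range x) →+* R :=
      ((Algebra.TensorProduct.includeRight : K →ₐ[k] L ⊗[k] K).toRingHom.comp
        (Algebra.adjoin k (Set.range x)).subtype).codRestrict R.toSubring fun c ↦ h1 c c.2
    obtain ⟨P, hP, hPa⟩ := ha
    refine ⟨P.map f, ?_, ?_⟩
    · rw [Polynomial.map_ne_zero_iff]
      · exact hP
      · intro c d hcd
        refine Subtype.ext (g.injective ?_)
        have := congrArg (fun r : R ↦ φ r) hcd
        simpa [f, hφ] using this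
    · have h2 := congrArg (Algebra.TensorProduct.includeRight : K →ₐ[k] L ⊗[k] K) hPa
      rw [map_zero, Polynomial.aeval_def, ← AlgHom.coe_toRingHom, Polynomial.hom_eval₂] at h2
      rw [Polynomial.aeval_def, Polynomial.eval₂_map]
      exact h2
  have halg (t : L ⊗[k] K) : IsAlgebraic R t := by
    induction t using TensorProduct.induction_on with
    | zero => exact isAlgebraic_zero
    | tmul a c =>
      rw [← mul_one a, ← smul_eq_mul, ← TensorProduct.smul_tmul', Algebra.smul_def]
      exact (isAlgebraic_algebraMap (algebraMap L R a)).mul (halgK c)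
    | add c d hc hd => exact hc.add hd
  obtain ⟨P, hP, hPz⟩ := halg z
  obtain ⟨Q, hQ, hQ0⟩ := Polynomial.exists_eq_pow_rootMultiplicity_mul_and_not_dvd P hP 0
  rw [map_zero, sub_zero] at hQ hQ0
  refine ⟨Polynomial.aeval z Q, ?_, ?_⟩
  · rw [Polynomial.X_dvd_iff, Polynomial.coeff_zero_eq_eval_zero] at hQ0
    have h1 : φ (Polynomial.aeval z Q) = ψ (Q.eval 0) := by
      rw [Polynomial.aeval_def, ← AlgHom.coe_toRingHom, Polynomial.hom_eval₂]
      simp only [AlgHom.coe_toRingHom, hz]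
      rw [show Q.eval 0 = Q.eval₂ (RingHom.id R) 0 from rfl, Polynomial.hom_eval₂, map_zero]
      rfl
    rw [h1]
    exact fun h0 ↦ hQ0 (hψ (h0.trans (map_zero ψ).symm))
  · refine IsReduced.eq_zero _ ⟨P.rootMultiplicity 0 + 1, ?_⟩
    rw [hQ, map_mul, map_pow, Polynomial.aeval_X] at hPz
    rw [mul_pow, pow_succ, pow_succ]
    calc _ = z ^ P.rootMultiplicity 0 * Polynomial.aeval z Q *
          (Polynomial.aeval z Q ^ P.rootMultiplicity 0 * z) := by ring
      _ = 0 := by rw [hPz, zero_mul]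

theorem notMem_closure_of_exists_mul_eq_zero {k L K U : Type*} [Field k] [Field L] [Field K]
    [Field U] [Algebra k L] [Algebra k K] [Algebra L U] [Algebra k U] [IsScalarTower k L U]
    (p : ℕ) [Fact p.Prime] [CharP k p] [IsReduced (L ⊗[k] K)] (g : K →ₐ[k] U)
    (hann : ∀ z, Algebra.TensorProduct.productLeftAlgHom (Algebra.ofId L U) g z = 0 →
      ∃ w, Algebra.TensorProduct.productLeftAlgHom (Algebra.ofId L U) g w ≠ 0 ∧ w * z = 0)
    (E : IntermediateField k K) (hE : ∀ a : K, a ^ p ∈ E) {s : K} (hs : s ∉ E) :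
    g s ∉ Subfield.closure (g '' E ∪ Set.range (algebraMap L U)) := by
  set φ := Algebra.TensorProduct.productLeftAlgHom (Algebra.ofId L U) g with hφ
  let m : L ⊗[k] E →ₐ[k] L ⊗[k] K := Algebra.TensorProduct.map (AlgHom.id k L) E.val
  have hpow (w : L ⊗[k] K) : ∃ t, m t = w ^ p := by
    have : ExpChar k p := .prime Fact.out
    nontriviality L ⊗[k] K
    have : ExpChar (L ⊗[k] K) p := expChar_of_injective_algebraMap (algebraMap k _).injective p
    induction w using TensorProduct.induction_on with
    | zero => exact ⟨0, by rw [map_zero, zero_pow (Fact.out : p.Prime).ne_zero]⟩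
    | tmul a c => exact ⟨(a ^ p) ⊗ₜ ⟨c ^ p, hE c⟩, by simp [m]⟩
    | add c d hc hd =>
      obtain ⟨t, ht⟩ := hc
      obtain ⟨u, hu⟩ := hd
      exact ⟨t + u, by rw [map_add, ht, hu, add_pow_expChar]⟩
  intro hmem
  obtain ⟨y, hy, z, hz, hyz⟩ := Subfield.mem_closure_iff.mp hmem
  have hle : Subring.closure (g '' E ∪ Set.range (algebraMap L U)) ≤
      (φ.toRingHom.comp m.toRingHom).range := by
    refine Subring.closure_le.mpr (Set.union_subset ?_ ?_)
    · rintro _ ⟨a, ha, rfl⟩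
      exact ⟨1 ⊗ₜ ⟨a, ha⟩, by simp [m, hφ]⟩
    · rintro _ ⟨a, rfl⟩
      exact ⟨a ⊗ₜ 1, by simp [m, hφ, Algebra.ofId_apply]⟩
  obtain ⟨t, rfl⟩ := hle hz
  obtain ⟨u, rfl⟩ := hle hy
  simp only [AlgHom.toRingHom_eq_coe, RingHom.comp_apply, RingHom.coe_coe] at hyz
  have hs0 : s ≠ 0 := fun h ↦ hs (h ▸ E.zero_mem)
  have ht0 : φ (m t) ≠ 0 := fun h ↦ hs0 ((map_eq_zero g).mp (by rw [← hyz, h, div_zero]))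
  obtain ⟨w, hw, hwz⟩ := hann ((1 ⊗ₜ s) * m t - m u) (by
    rw [map_sub, map_mul, show φ (1 ⊗ₜ s) = g s by simp [hφ], ← hyz,
      div_mul_cancel₀ _ ht0, sub_self])
  obtain ⟨v, hv⟩ := hpow w
  have hmul : (1 ⊗ₜ s) * m (v * t) = m (v * u) := by
    obtain ⟨n, hn⟩ := Nat.exists_eq_succ_of_ne_zero (Fact.out : p.Prime).ne_zero
    rw [map_mul, map_mul, hv, hn, ← sub_eq_zero, pow_succ]
    linear_combination w ^ n * hwz
  obtain ⟨f, hfs, hf⟩ := Submodule.exists_dual_map_eq_bot_of_notMem (p := (1 : Submodule E K))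
    (x := s) (by rintro ⟨a, rfl⟩; exact hs (by simp [IntermediateField.smul_def])) inferInstance
  have hfE (a : E) : f (a : K) = 0 := by
    have : f (a : K) ∈ Submodule.map f 1 := ⟨a, ⟨a, by simp [IntermediateField.smul_def]⟩, rfl⟩
    rwa [hf] at this
  let Λ : L ⊗[k] K →ₗ[k] L ⊗[k] K :=
    LinearMap.lTensor L (E.val.toLinearMap ∘ₗ f.restrictScalars k)
  have hΛ0 (t : L ⊗[k] E) : Λ (m t) = 0 := by
    induction t using TensorProduct.induction_on with
    | zero => simp
    | tmul a c => simp [m, Λ, hfE]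
    | add c d hc hd => rw [map_add, map_add, hc, hd, add_zero]
  have hΛs (t : L ⊗[k] E) : Λ ((1 ⊗ₜ s) * m t) = (1 ⊗ₜ (f s : K)) * m t := by
    induction t using TensorProduct.induction_on with
    | zero => simp
    | tmul a c =>
      have : f (s * c) = f s * c := by
        rw [mul_comm, ← smul_eq_mul, ← IntermediateField.smul_def, map_smul, smul_eq_mul, mul_comm]
      simp [m, Λ, this]
    | add c d hc hd => rw [map_add, mul_add, map_add, hc, hd, mul_add]
  have h0 := hΛs (v * t)
  rw [hmul, hΛ0, map_mul, hv] at h0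
  have h1 := congrArg φ h0
  rw [map_zero, map_mul, map_mul, map_pow, show φ (1 ⊗ₜ (f s : K)) = g (f s) by simp [hφ]] at h1
  refine mul_ne_zero ?_ (mul_ne_zero (pow_ne_zero p hw) ht0) h1.symm
  simpa using hfs

/-- If `k ⊆ K`, `k ⊆ L`, `K ⊆ U` and `L ⊆ U` are separable, `K` is algebraically
independent from `L` over `k`, and the extension `KL ⊆ U` of the compositum is
separable, then `K` is `p`-independent from `L` over `k` in `U`. -/
theorem pIndepFrom_of_sepExt_compositum_ambient
    {p : ℕ} (hp : p.Prime) {U : Type*} [Field U] [CharP U p]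
    (k K L : Subfield U) (hkK : k ≤ K) (hkL : k ≤ L)
    (hsK : SepExt p k K) (hsL : SepExt p k L)
    (hsKU : SepExt p K ⊤) (hsLU : SepExt p L ⊤)
    (hfree : AlgIndepFrom k K L) (hsKLU : SepExt p (K ⊔ L) ⊤) :
    ∀ S : Set U, S ⊆ (K : Set U) →
      PIndepOver p k ⊤ S → PIndepOver p L ⊤ S := by
  intro S hSK hS s hsS hmem
  have : Fact p.Prime := ⟨hp⟩
  have : CharP k p := (algebraMap k U).charP (algebraMap k U).injective p
  let K' : IntermediateField k U := K.toIntermediateField fun x ↦ hkK x.2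
  let L' : IntermediateField k U := L.toIntermediateField fun x ↦ hkL x.2
  have hred : IsReduced (L' ⊗[k] K') := by
    refine isReduced_tensorProduct_of_linearIndependent_pow p fun v hv ↦ ?_
    have := hsK.linearIndependent_pow hkK (v := fun i ↦ (v i : U)) (fun i ↦ (v i).2)
      (hv.map' K'.val.toLinearMap (LinearMap.ker_eq_bot.mpr K'.val.injective))
    exact .of_comp K'.val.toLinearMap this
  have : FaithfulSMul k K' :=
    (faithfulSMul_iff_algebraMap_injective k K').mpr (algebraMap k K').injective
  obtain ⟨T, hT⟩ := exists_isTranscendenceBasis k K'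
  have hTk : AlgebraicIndependent k ((↑) : K'.val '' T → U) :=
    (hT.1.map' (f := K'.val) K'.val.injective).to_subtype_range' (by
      ext; simp)
  have hTL : AlgebraicIndependent L' (fun t : T ↦ K'.val t) := by
    have h1 := (hfree (K'.val '' T) (by rintro _ ⟨a, -, rfl⟩; exact a.2)
      hTk.algIndepOver).algebraicIndependent
    exact h1.comp (fun t : T ↦ (⟨K'.val t, t, t.2, rfl⟩ : K'.val '' T)) fun a b h ↦
      Subtype.ext (Subtype.ext (Subtype.mk.inj h))
  let E₀ : Subfield U :=
    Subfield.closure ((fun x ↦ x ^ p) '' (K : Set U) ∪ k ∪ (S \ {s}))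
  let E : IntermediateField k K' := (E₀.comap (algebraMap K' U)).toIntermediateField
    fun x ↦ Subfield.subset_closure (.inl (.inr x.2))
  have hsE : (⟨s, hSK hsS⟩ : K') ∉ E := fun h ↦ hS s hsS <| by
    refine Subfield.closure_mono (Set.union_subset_union_left _ (Set.union_subset_union_left _
      (Set.image_mono fun _ _ ↦ ?_))) h
    exact Subfield.mem_top _
  refine notMem_closure_of_exists_mul_eq_zero p K'.val
    (fun z ↦ exists_mul_eq_zero_of_algebraicIndependent K'.val hT hTL) E
    (fun a ↦ Subfield.subset_closure (.inl (.inl ⟨a, a.2, rfl⟩))) hsE ?_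
  set N := Subfield.closure (K'.val '' E ∪ Set.range (algebraMap L' U))
  have hE₀K : E₀ ≤ K := by
    refine Subfield.closure_le.mpr (Set.union_subset (Set.union_subset ?_ hkK) ?_)
    · rintro _ ⟨x, hx, rfl⟩
      exact K.pow_mem hx p
    · exact Set.sdiff_subset.trans hSK
  have hEN : E₀ ≤ N := fun x hx ↦
    Subfield.subset_closure (.inl ⟨⟨x, hE₀K hx⟩, hx, rfl⟩)
  have hLN : L ≤ N := fun x hx ↦ Subfield.subset_closure (.inr ⟨⟨x, hx⟩, rfl⟩)
  have hNKL : N ≤ K ⊔ L := by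
    refine Subfield.closure_le.mpr (Set.union_subset ?_ ?_)
    · rintro _ ⟨x, -, rfl⟩
      exact (le_sup_left : K ≤ K ⊔ L) x.2
    · rintro _ ⟨x, rfl⟩
      exact (le_sup_right : L ≤ K ⊔ L) x.2
  have hpN : (K ⊔ L).pPow p ≤ N := by
    have : K ⊔ L ≤ N.comap (frobenius U p) := sup_le
      (fun x hx ↦ hEN (Subfield.subset_closure (.inl (.inl ⟨x, hx, rfl⟩))))
      (fun x hx ↦ N.pow_mem (hLN hx) p)
    intro x hx
    obtain ⟨y, hy, rfl⟩ := Subfield.mem_pPow.mp hx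
    exact this hy
  refine hsKLU.mem_of_mem_closure hpN hNKL ((le_sup_left : K ≤ K ⊔ L) (hSK hsS)) ?_
  refine Subfield.closure_mono ?_ hmem
  rw [Set.union_assoc]
  refine Set.union_subset_union_right _ (Set.union_subset hLN fun x hx ↦ ?_)
  exact hEN (Subfield.subset_closure (.inr hx))
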